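/- Let (A, X, I) be a formal context with X finite and let m₁, m₂ be mass functions on X. If m₁ ≤_s m₂ (m₁ is a specialization of m₂), then ρ_{m₁}(G) ≤ ρ_{m₂}(G) for every G ⊆ A, and 𝒞(m₁, β) ⊆ 𝒞(m₂, β) for every β ∈ [0,1]. -/

import Mathlib

open scoped Classical

noncomputable section

/-- In a formal context `(A, X, I)` (with `I ⊆ A × X`), a set `B ⊆ A` is a `Y`-extent
(for `Y ⊆ X`) if `B = {a | ∀ x ∈ Y', (a, x) ∈ I}` for some `Y' ⊆ Y`. -/
def IsExtent {A X : Type*} (I : Set (A × X)) (Y : Set X) (B : Set A) : Prop :=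
  ∃ Y' ⊆ Y, B = {a : A | ∀ x ∈ Y', (a, x) ∈ I}

/-- A (Dempster-Shafer) mass function on a finite set `X`:
a map `𝒫(X) → [0,1]` whose values sum to `1`. -/
def IsMass {X : Type*} [Fintype X] (m : Finset X → ℝ) : Prop :=
  (∀ Y : Finset X, 0 ≤ m Y ∧ m Y ≤ 1) ∧ ∑ Y : Finset X, m Y = 1

/-- The stability index `ρ_m(G) = Σ_{Y ⊆ X, G is a Y-extent} m(Y)`. -/
def stabilityIndex {A X : Type*} [Fintype X] (I : Set (A × X)) (m : Finset X → ℝ)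
    (G : Set A) : ℝ :=
  ∑ Y : Finset X, if IsExtent I (Y : Set X) G then m Y else 0

/-- `𝒞(m, β)`: the sets `G ⊆ A` which are `Y`-extents for some `Y ⊆ X` and
whose stability index is at least `β`. -/
def Csys {A X : Type*} [Fintype X] (I : Set (A × X)) (m : Finset X → ℝ) (β : ℝ) :
    Set (Set A) :=
  {G | (∃ Y : Set X, IsExtent I Y G) ∧ β ≤ stabilityIndex I m G}

/-- `𝕃(m, β)`: all intersections of (possibly empty) subfamilies of `𝒞(m, β)`. -/
def Lsys {A X : Type*} [Fintype X] (I : Set (A × X)) (m : Finset X → ℝ) (β : ℝ) :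
    Set (Set A) :=
  {L | ∃ 𝒢 ⊆ Csys I m β, L = ⋂₀ 𝒢}

/-- A family `𝒱 ⊆ 𝒫(X)` is upward closed w.r.t. inclusion. -/
def UpwardClosed {X : Type*} (𝒱 : Finset (Finset X)) : Prop :=
  ∀ Y ∈ 𝒱, ∀ Z : Finset X, Y ⊆ Z → Z ∈ 𝒱

/-- The upward restricted order `m₁ ≤_↑ m₂`. -/
def UpOrder {X : Type*} [Fintype X] (m₁ m₂ : Finset X → ℝ) : Prop :=
  ∀ 𝒱 : Finset (Finset X), UpwardClosed 𝒱 →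
    ∑ Y ∈ 𝒱, m₁ Y ≤ ∑ Y ∈ 𝒱, m₂ Y

/-- `S` is a specialization matrix witnessing `m₁ ≤_s m₂`. -/
def IsSpecMatrix {X : Type*} [Fintype X] (S : Finset X → Finset X → ℝ)
    (m₁ m₂ : Finset X → ℝ) : Prop :=
  (∀ W Y : Finset X, 0 ≤ S W Y ∧ S W Y ≤ 1) ∧
  (∀ Y : Finset X, ∑ W : Finset X, S W Y = 1) ∧
  (∀ W Y : Finset X, 0 < S W Y → W ⊆ Y) ∧
  (∀ W : Finset X, m₁ W = ∑ Y : Finset X, S W Y * m₂ Y)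

/-- The specialization order `m₁ ≤_s m₂`. -/
def SpecOrder {X : Type*} [Fintype X] (m₁ m₂ : Finset X → ℝ) : Prop :=
  ∃ S : Finset X → Finset X → ℝ, IsSpecMatrix S m₁ m₂

/-- The quality function `q_m(Y) = Σ_{Y ⊆ Z} m(Z)`. -/
def quality {X : Type*} [Fintype X] (m : Finset X → ℝ) (Y : Finset X) : ℝ :=
  ∑ Z : Finset X, if Y ⊆ Z then m Z else 0

/-- The plausibility function `pl_m(Y) = Σ_{Z ∩ Y ≠ ∅} m(Z)`. -/
def plausibility {X : Type*} [Fintype X] (m : Finset X → ℝ) (Y : Finset X) : ℝ :=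
  ∑ Z : Finset X, if (Z ∩ Y).Nonempty then m Z else 0

/-- The unnormalized Dempster combination `(m₁ ∩_m m₂)(Y) = Σ_{Z₁ ∩ Z₂ = Y} m₁(Z₁)·m₂(Z₂)`. -/
def interComb {X : Type*} [Fintype X] (m₁ m₂ : Finset X → ℝ) (Y : Finset X) : ℝ :=
  ∑ Z : Finset X × Finset X, if Z.1 ∩ Z.2 = Y then m₁ Z.1 * m₂ Z.2 else 0

/-- The disjunctive combination `(m₁ ∪_m m₂)(Y) = Σ_{Z₁ ∪ Z₂ = Y} m₁(Z₁)·m₂(Z₂)`. -/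
def unionComb {X : Type*} [Fintype X] (m₁ m₂ : Finset X → ℝ) (Y : Finset X) : ℝ :=
  ∑ Z : Finset X × Finset X, if Z.1 ∪ Z.2 = Y then m₁ Z.1 * m₂ Z.2 else 0

/-- The combined agenda `(◇c)(Y) = Σ_{(Z_j) : ⋂_j Z_j = Y} Π_j m_j(Z_j)`,
for a finite nonempty index set of agents `ι`. -/
def diamondAgenda {ι X : Type*} [Fintype ι] [Fintype X] (m : ι → Finset X → ℝ)
    (Y : Finset X) : ℝ :=
  ∑ Z : ι → Finset X,
    if (⋂ j, (Z j : Set X)) = (Y : Set X) then ∏ j, m j (Z j) else 0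

/-- The distributed agenda `(▷c)(Y) = Σ_{(Z_j) : ⋃_j Z_j = Y} Π_j m_j(Z_j)`,
for a finite nonempty index set of agents `ι`. -/
def triangleAgenda {ι X : Type*} [Fintype ι] [Fintype X] (m : ι → Finset X → ℝ)
    (Y : Finset X) : ℝ :=
  ∑ Z : ι → Finset X,
    if (⋃ j, (Z j : Set X)) = (Y : Set X) then ∏ j, m j (Z j) else 0

end
/-- Being an extent is monotone in the set of attributes. -/
theorem IsExtent.mono {A X : Type*} {I : Set (A × X)} {Y Z : Set X} {G : Set A}
    (h : IsExtent I Y G) (hYZ : Y ⊆ Z) : IsExtent I Z G :=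
  let ⟨Y', hY', hG⟩ := h
  ⟨Y', hY'.trans hYZ, hG⟩

/-- The specialization order is contained in the upward restricted order, provided the larger
function is nonnegative. -/
theorem SpecOrder.upOrder {X : Type*} [Fintype X] {m₁ m₂ : Finset X → ℝ}
    (h : SpecOrder m₁ m₂) (hm₂ : ∀ Y, 0 ≤ m₂ Y) : UpOrder m₁ m₂ := by
  obtain ⟨S, hS, hsum, hsub, hm₁⟩ := h
  intro 𝒱 h𝒱
  have key (Y : Finset X) : ∑ W ∈ 𝒱, S W Y ≤ if Y ∈ 𝒱 then 1 else 0 := by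
    split_ifs with hY
    · rw [← hsum Y]
      exact Finset.sum_le_univ_sum_of_nonneg fun W => (hS W Y).1
    · refine Finset.sum_nonpos fun W hW => not_lt.1 fun hpos => hY ?_
      exact h𝒱 W hW Y (hsub W Y hpos)
  calc ∑ W ∈ 𝒱, m₁ W = ∑ Y, (∑ W ∈ 𝒱, S W Y) * m₂ Y := by
        simp_rw [hm₁, Finset.sum_mul]
        exact Finset.sum_comm
    _ ≤ ∑ Y, (if Y ∈ 𝒱 then 1 else 0) * m₂ Y :=
        Finset.sum_le_sum fun Y _ => mul_le_mul_of_nonneg_right (key Y) (hm₂ Y)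
    _ = ∑ Y ∈ 𝒱, m₂ Y := by simp

/-- The stability index is monotone in the upward restricted order. -/
theorem UpOrder.stabilityIndex_le {A X : Type*} [Fintype X] {m₁ m₂ : Finset X → ℝ}
    (h : UpOrder m₁ m₂) (I : Set (A × X)) (G : Set A) :
    stabilityIndex I m₁ G ≤ stabilityIndex I m₂ G := by
  unfold stabilityIndex
  rw [← Finset.sum_filter, ← Finset.sum_filter]
  refine h _ fun Y hY Z hYZ => ?_
  simp only [Finset.mem_filter, Finset.mem_univ, true_and] at hY ⊢
  exact hY.mono (Finset.coe_subset.2 hYZ)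

theorem specOrder_stabilityIndex_Csys {A X : Type*} [Fintype X] (I : Set (A × X))
    (m₁ m₂ : Finset X → ℝ) (hm₁ : IsMass m₁) (hm₂ : IsMass m₂)
    (h : SpecOrder m₁ m₂) :
    (∀ G : Set A, stabilityIndex I m₁ G ≤ stabilityIndex I m₂ G) ∧
    (∀ β : ℝ, 0 ≤ β → β ≤ 1 → Csys I m₁ β ⊆ Csys I m₂ β) := by
  have hle (G : Set A) : stabilityIndex I m₁ G ≤ stabilityIndex I m₂ G :=
    (h.upOrder fun Y => (hm₂.1 Y).1).stabilityIndex_le I G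
  exact ⟨hle, fun β _ _ G hG => ⟨hG.1, hG.2.trans (hle G)⟩⟩
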